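/- Low explanation fidelity does not preclude maximal decision fidelity: let X be a type of inputs, Y a type of decisions, V a real normed vector space, M : X → Y a model, and H* : X → V a reference explanation map with H* x ≠ 0 for all x, such that some classifier g* : V → Y satisfies g* (H* x) = M x for all x. Then for every real bound B there exists c > 0 and a deceptive explanation map H^D := fun x => c • H* x such that for every input x the explanation fidelity 1 − ‖H* x − H^D x‖ / ‖H* x‖ is less than B, while there still exists a classifier g : V → Y with g (H^D x) = M x for all x. -/

import Mathlib

/-- Low explanation fidelity does not preclude maximal decision fidelity:
rescaling by a suitable `c > 0` drives explanation fidelity below any bound `B`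
while a classifier still recovers all decisions from the rescaled explanations. -/
theorem low_explanation_fidelity_max_decision_fidelity
    (X Y V : Type) [NormedAddCommGroup V] [NormedSpace ℝ V]
    (M : X → Y) (Hstar : X → V) (hH : ∀ x : X, Hstar x ≠ 0)
    (gstar : V → Y) (hg : ∀ x : X, gstar (Hstar x) = M x)
    (B : ℝ) :
    ∃ c : ℝ, 0 < c ∧
      (∀ x : X, 1 - ‖Hstar x - (fun x => c • Hstar x) x‖ / ‖Hstar x‖ < B) ∧
      (∃ g : V → Y, ∀ x : X, g ((fun x => c • Hstar x) x) = M x) := by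
  have hc : 0 < 3 + |B| := by positivity
  refine ⟨3 + |B|, hc, fun x => ?_, fun v => gstar ((3 + |B|)⁻¹ • v), fun x => ?_⟩
  · have hdiff : Hstar x - (3 + |B|) • Hstar x = -((2 + |B|) • Hstar x) := by module
    have hnorm : ‖Hstar x - (3 + |B|) • Hstar x‖ = (2 + |B|) * ‖Hstar x‖ := by
      rw [hdiff, norm_neg, norm_smul, Real.norm_of_nonneg (by positivity)]
    beta_reduce
    rw [hnorm, mul_div_cancel_right₀ _ (norm_ne_zero_iff.mpr (hH x))]
    linarith [neg_abs_le B]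
  · beta_reduce
    rw [inv_smul_smul₀ hc.ne', hg]
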